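/- arXiv:1206.3766 — 3 statements merged into one kernel-verified Lean document; each statement's English description precedes it below -/
import Mathlib

section
/- Let k ≥ 2 be a natural number and let p ∈ (0, π/4). There exists η₀ > 0 such that for every η ∈ (0, η₀) and every ε > 0 there exist δ > 0 with 0 < p − 2δ and smooth functions φ, ν : [0, π] → ℝ with the following properties: (1) |φ(r) − sin r| < ε, |φ′(r) − cos r| < ε, and |φ″(r) + sin r| < ε for all r ∈ [0, π] \ (p − δ, p + δ); moreover φ″(p) = η > 0 and φ″(r) ≤ η for all r ∈ [0, π]; (2) |φ(r) − sin r| < ε and |φ′(r) − cos r| < ε for all r ∈ [0, π], φ(r) = sin r for all r in some neighborhood of 0 and some neighborhood of π, and φ(r) > 0 for all r ∈ (0, π); (3) ν is constant on some neighborhood of 0 and on some neighborhood of π; (4) for every r ∈ (p − 2δ, p + δ): ν″(r) + ν′(r)² < −φ″(r)/(k·φ(r)) and ν′(r)·φ′(r) < −φ″(r)/k; (5) for every r ∈ [0, π] \ (p − 2δ, p + δ): |ν(r)| ≤ 20η/k, |ν′(r)| ≤ 20η/k, and |ν″(r)| ≤ 20η/k. -/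
open Real Set

lemma exists_antideriv (f : ℝ → ℝ) (hf : ContDiff ℝ (⊤ : ℕ∞) f) (a : ℝ) :
    ∃ F : ℝ → ℝ, ContDiff ℝ (⊤ : ℕ∞) F ∧ (∀ x, HasDerivAt F (f x) x) ∧
      ∀ x, F x = ∫ t in a..x, f t := by
  have h : ∀ x, HasDerivAt (fun x => ∫ t in a..x, f t) (f x) x := fun x =>
    intervalIntegral.integral_hasDerivAt_right (hf.continuous.intervalIntegrable _ _)
      hf.continuous.stronglyMeasurable.stronglyMeasurableAtFilter hf.continuous.continuousAt
  refine ⟨fun x => ∫ t in a..x, f t, ?_, h, fun x => rfl⟩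
  rw [contDiff_infty_iff_deriv]
  refine ⟨fun x => (h x).differentiableAt, ?_⟩
  rw [show deriv (fun x => ∫ t in a..x, f t) = f from funext fun x => (h x).deriv]
  exact hf

lemma exists_step (c r1 r2 : ℝ) (h1 : 0 < r1) (h12 : r1 < r2) :
    ∃ S s : ℝ → ℝ, ContDiff ℝ (⊤ : ℕ∞) S ∧ ContDiff ℝ (⊤ : ℕ∞) s ∧
      (∀ x, HasDerivAt S (s x) x) ∧ (∀ x, 0 ≤ s x) ∧ (∀ x, s x ≤ 1 / (2 * r1)) ∧
      (∀ x, |x - c| ≤ r1 → 1 / (2 * r2) ≤ s x) ∧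
      (∀ x, r2 ≤ |x - c| → s x = 0) ∧
      (∀ x, x ≤ c - r2 → S x = 0) ∧ (∀ x, c + r2 ≤ x → S x = 1) ∧
      (∀ x, 0 ≤ S x) ∧ (∀ x, S x ≤ 1) := by
  let f : ContDiffBump c := ⟨r1, r2, h1, h12⟩
  have hs : ContDiff ℝ (⊤ : ℕ∞) (f.normed MeasureTheory.volume) := f.contDiff_normed
  obtain ⟨S, hS, hd, hint⟩ := exists_antideriv _ hs (c - r2)
  have hI1 : 2 * r1 ≤ ∫ x, f x := by
    have := f.measure_closedBall_le_integral MeasureTheory.volume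
    rw [Real.volume_real_closedBall h1.le] at this
    exact this
  have hI2 : ∫ x, f x ≤ 2 * r2 := by
    have := f.integral_le_measure_closedBall MeasureTheory.volume
    rw [Real.volume_real_closedBall (h1.trans h12).le] at this
    exact this
  have hI0 : 0 < ∫ x, f x := by linarith
  have hn : ∀ x, f.normed MeasureTheory.volume x = f x / ∫ x, f x := fun x => f.normed_def _
  have hz : ∀ x, r2 ≤ |x - c| → f.normed MeasureTheory.volume x = 0 := by
    intro x hx
    rw [hn, f.zero_of_le_dist (by rw [Real.dist_eq]; exact hx), zero_div]
  have h0 : ∀ x, 0 ≤ f.normed MeasureTheory.volume x := fun x => f.nonneg_normed x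
  have hmono : Monotone S := by
    apply monotone_of_deriv_nonneg (fun x => (hd x).differentiableAt)
    intro x; rw [(hd x).deriv]; exact h0 x
  have hS0 : ∀ x, x ≤ c - r2 → S x = 0 := by
    intro x hx
    rw [hint, intervalIntegral.integral_congr (g := fun _ => (0:ℝ))]
    · simp
    · intro t ht
      rw [uIcc_of_ge hx] at ht
      apply hz
      rw [abs_sub_comm]
      exact le_trans (by linarith [ht.2]) (le_abs_self _)
  have hS1 : ∀ x, c + r2 ≤ x → S x = 1 := by
    intro x hx
    rw [hint, intervalIntegral.integral_eq_integral_of_support_subset, f.integral_normed]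
    rw [f.support_normed_eq, Real.ball_eq_Ioo]
    exact fun t ht => ⟨ht.1, ht.2.le.trans hx⟩
  refine ⟨S, _, hS, hs, hd, h0, ?_, ?_, hz, hS0, hS1, ?_, ?_⟩
  · intro x
    rw [hn]
    exact div_le_div₀ zero_le_one f.le_one (by linarith) hI1
  · intro x hx
    rw [hn, f.one_of_mem_closedBall (by rw [Metric.mem_closedBall, Real.dist_eq]; exact hx)]
    exact one_div_le_one_div_of_le hI0 hI2
  · intro x
    rcases le_total x (c - r2) with h | h
    · exact (hS0 x h).ge
    · rw [← hS0 _ le_rfl]; exact hmono h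
  · intro x
    rcases le_total x (c + r2) with h | h
    · rw [← hS1 _ le_rfl]; exact hmono h
    · exact (hS1 x h).le

lemma mvt_le {F f : ℝ → ℝ} (hd : ∀ x, HasDerivAt F (f x) x) {a b C : ℝ} (hab : a ≤ b)
    (h : ∀ x ∈ Icc a b, f x ≤ C) : F b - F a ≤ C * (b - a) := by
  apply (convex_Icc a b).image_sub_le_mul_sub_of_deriv_le
    (fun x _ => (hd x).continuousAt.continuousWithinAt)
    (fun x _ => (hd x).differentiableAt.differentiableWithinAt)
    (fun x hx => by rw [(hd x).deriv]; exact h x (interior_subset hx))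
    a ⟨le_rfl, hab⟩ b ⟨hab, le_rfl⟩ hab

lemma le_mvt {F f : ℝ → ℝ} (hd : ∀ x, HasDerivAt F (f x) x) {a b C : ℝ} (hab : a ≤ b)
    (h : ∀ x ∈ Icc a b, C ≤ f x) : C * (b - a) ≤ F b - F a := by
  apply (convex_Icc a b).mul_sub_le_image_sub_of_le_deriv
    (fun x _ => (hd x).continuousAt.continuousWithinAt)
    (fun x _ => (hd x).differentiableAt.differentiableWithinAt)
    (fun x hx => by rw [(hd x).deriv]; exact h x (interior_subset hx))
    a ⟨le_rfl, hab⟩ b ⟨hab, le_rfl⟩ hab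

lemma exists_H (p d η : ℝ) (hd : 0 < d) (hη : 0 < η) (hη1 : η ≤ 1) (hp : 0 < p - d)
    (hpd : p + d < π) :
    ∃ H H1 H2 : ℝ → ℝ, ContDiff ℝ (⊤ : ℕ∞) H ∧
      (∀ x, HasDerivAt H (H1 x) x) ∧ (∀ x, HasDerivAt H1 (H2 x) x) ∧
      (∀ x, x ≤ p - d → H x = 0) ∧ (∀ x, 0 ≤ H1 x) ∧ (∀ x, H1 x ≤ 4 * d) ∧
      (∀ x, 0 ≤ x → 0 ≤ H x) ∧ (∀ x, 0 ≤ x → H x ≤ 4 * d * x) ∧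
      (∀ x, d ≤ |x - p| → H2 x = 0) ∧ (∀ x ∈ Icc 0 π, H2 x ≤ sin x + η) ∧
      H2 p = sin p + η := by
  let f : ContDiffBump p := ⟨d / 2, d, by linarith, by linarith⟩
  have hs : ContDiff ℝ (⊤ : ℕ∞) (fun x => f x * (sin x + η)) :=
    f.contDiff.mul (Real.contDiff_sin.add contDiff_const)
  obtain ⟨H1, hH1, hd1, hint1⟩ := exists_antideriv _ hs 0
  obtain ⟨H, hH, hd0, hint0⟩ := exists_antideriv _ hH1 0
  have hz : ∀ x, d ≤ |x - p| → f x * (sin x + η) = 0 := by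
    intro x hx
    rw [f.zero_of_le_dist (by rw [Real.dist_eq]; exact hx), zero_mul]
  have hnn : ∀ x, 0 ≤ f x * (sin x + η) := by
    intro x
    rcases le_total d |x - p| with h | h
    · exact (hz x h).ge
    · rw [abs_le] at h
      have := sin_nonneg_of_nonneg_of_le_pi (x := x) (by linarith) (by linarith)
      exact mul_nonneg f.nonneg (by linarith)
  have hle2 : ∀ x, f x * (sin x + η) ≤ 2 := by
    intro x
    nlinarith [f.nonneg (x := x), f.le_one (x := x), sin_le_one x]
  have e1 : H1 0 = 0 := by rw [hint1]; simp
  have e0 : H 0 = 0 := by rw [hint0]; simp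
  have m1 : Monotone H1 := by
    apply monotone_of_deriv_nonneg (fun x => (hd1 x).differentiableAt)
    intro x; rw [(hd1 x).deriv]; exact hnn x
  have z1 : ∀ x, x ≤ p - d → H1 x = 0 := by
    have key : ∀ a b, a ≤ b → b ≤ p - d → H1 b = H1 a := by
      intro a b hab hb
      have h := mvt_le hd1 hab (C := 0) (fun x hx => (hz x (by
        rw [abs_sub_comm]; exact le_trans (by linarith [hx.2]) (le_abs_self _))).le)
      have := m1 hab
      linarith
    intro x hx
    rw [← e1]
    rcases le_total x 0 with h | h
    · rw [key x 0 h hp.le]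
    · rw [key 0 x h hx]
  have n1 : ∀ x, 0 ≤ H1 x := by
    intro x
    rcases le_total x (p - d) with h | h
    · exact (z1 x h).ge
    · rw [← z1 _ le_rfl]; exact m1 h
  have u1 : ∀ x, H1 x ≤ 4 * d := by
    have A : H1 (p + d) ≤ 4 * d := by
      have h := mvt_le hd1 (a := p - d) (b := p + d) (by linarith) (C := 2) (fun x _ => hle2 x)
      rw [z1 _ le_rfl] at h; linarith
    intro x
    rcases le_total x (p + d) with h | h
    · exact (m1 h).trans A
    · have h := mvt_le hd1 h (C := 0) (fun x hx => (hz x (by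
        exact le_trans (by linarith [hx.1]) (le_abs_self _))).le)
      linarith
  have z0 : ∀ x, x ≤ p - d → H x = 0 := by
    have key : ∀ a b, a ≤ b → b ≤ p - d → H b = H a := by
      intro a b hab hb
      have h := mvt_le hd0 hab (C := 0) (fun x hx => (z1 x (hx.2.trans hb)).le)
      have h' := le_mvt hd0 hab (C := 0) (fun x hx => n1 x)
      linarith
    intro x hx
    rw [← e0]
    rcases le_total x 0 with h | h
    · rw [key x 0 h hp.le]
    · rw [key 0 x h hx]
  refine ⟨H, H1, _, hH, hd0, hd1, z0, n1, u1, ?_, ?_, hz, ?_, ?_⟩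
  · intro x hx
    have h' := le_mvt hd0 hx (C := 0) (fun x hx => n1 x)
    linarith
  · intro x hx
    have h' := mvt_le hd0 hx (C := 4 * d) (fun x hx => u1 x)
    linarith
  · intro x hx
    have := sin_nonneg_of_nonneg_of_le_pi hx.1 hx.2
    nlinarith [f.nonneg (x := x), f.le_one (x := x)]
  · rw [f.one_of_mem_closedBall (by simp [f]; linarith), one_mul]

set_option maxHeartbeats 4000000 in
/-- Lemma 1 of the paper: given `k ≥ 2` and `p ∈ (0, π/4)`, there is `η₀ > 0` such that
for all sufficiently small `η > 0` and any `ε > 0`, one can find `δ > 0` and smooth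
functions `φ, ν` on `[0, π]` (here realized as smooth functions on `ℝ`, restricted to
`[0, π]`) satisfying the five properties of the lemma. -/
theorem lemma_incomprehensible (k : ℕ) (hk : 2 ≤ k) (p : ℝ) (hp : p ∈ Ioo 0 (π / 4)) :
    ∃ η₀ > (0 : ℝ), ∀ η ∈ Ioo (0 : ℝ) η₀, ∀ ε > (0 : ℝ),
      ∃ δ > (0 : ℝ), 0 < p - 2 * δ ∧
        ∃ φ ν : ℝ → ℝ, ContDiff ℝ (⊤ : ℕ∞) φ ∧ ContDiff ℝ (⊤ : ℕ∞) ν ∧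
          -- (1) C²-closeness to sin away from (p - δ, p + δ), and φ'' maximal at p with value η
          (∀ r ∈ Icc (0 : ℝ) π \ Ioo (p - δ) (p + δ),
            |φ r - Real.sin r| < ε ∧ |deriv φ r - Real.cos r| < ε ∧
              |deriv (deriv φ) r + Real.sin r| < ε) ∧
          deriv (deriv φ) p = η ∧
          (∀ r ∈ Icc (0 : ℝ) π, deriv (deriv φ) r ≤ η) ∧
          -- (2) C¹-closeness to sin everywhere, φ = sin near the endpoints, φ > 0 on (0, π)
          (∀ r ∈ Icc (0 : ℝ) π, |φ r - Real.sin r| < ε ∧ |deriv φ r - Real.cos r| < ε) ∧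
          (∀ᶠ r in nhds (0 : ℝ), φ r = Real.sin r) ∧
          (∀ᶠ r in nhds π, φ r = Real.sin r) ∧
          (∀ r ∈ Ioo (0 : ℝ) π, 0 < φ r) ∧
          -- (3) ν constant near the endpoints
          (∃ c : ℝ, ∀ᶠ r in nhds (0 : ℝ), ν r = c) ∧
          (∃ c : ℝ, ∀ᶠ r in nhds π, ν r = c) ∧
          -- (4) the differential inequalities on (p - 2δ, p + δ)
          (∀ r ∈ Ioo (p - 2 * δ) (p + δ),
            deriv (deriv ν) r + (deriv ν r) ^ 2 < -(deriv (deriv φ) r) / (k * φ r) ∧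
            deriv ν r * deriv φ r < -(deriv (deriv φ) r) / k) ∧
          -- (5) C²-smallness of ν away from (p - 2δ, p + δ)
          (∀ r ∈ Icc (0 : ℝ) π \ Ioo (p - 2 * δ) (p + δ),
            |ν r| ≤ 20 * η / k ∧ |deriv ν r| ≤ 20 * η / k ∧
              |deriv (deriv ν) r| ≤ 20 * η / k) := by
  obtain ⟨hp0, hp4⟩ := hp
  have hpi := Real.pi_gt_three
  have hpi' := Real.pi_lt_d2
  obtain ⟨S, s, hSs, hss, hSd, hs0, hs1, -, hsz, hSz, hSo, hS0, hS1⟩ :=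
    exists_step 2 (1 / 2) 1 (by norm_num) (by norm_num)
  obtain ⟨M, hM⟩ := (isCompact_Icc (a := (0:ℝ)) (b := π)).exists_bound_of_continuousOn
    (f := deriv s) ((hss.continuous_deriv (by simp)).continuousOn)
  have hM0 : 0 ≤ M := (norm_nonneg _).trans (hM 0 ⟨le_rfl, by linarith⟩)
  have hsd : ∀ x, HasDerivAt s (deriv s x) x := fun x =>
    (hss.differentiable (by simp) x).hasDerivAt
  refine ⟨1 / 10, by norm_num, ?_⟩
  rintro η ⟨hη0, hη1⟩ ε hε
  set s0 := sin (p / 2) with hs0def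
  have hs0pos : 0 < s0 := sin_pos_of_pos_of_lt_pi (by linarith) (by linarith)
  have hs0le : s0 ≤ 1 := sin_le_one _
  have hMp : 0 < 4 * M + 11 := by linarith
  obtain ⟨δ, hδ0, hδp, hδs, hδ1, hδe, hδη⟩ : ∃ δ > (0:ℝ), δ ≤ p / 5 ∧ δ ≤ s0 / 4 ∧ δ ≤ 1 / 20 ∧
      (4 * M + 10) * δ < ε ∧ (4 * M + 10) * δ < η := by
    refine ⟨min (min (p / 5) (s0 / 4)) (min (1 / 20) (min (ε / (4 * M + 11)) (η / (4 * M + 11)))),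
      by positivity, ?_⟩
    set δ := min (min (p / 5) (s0 / 4)) (min (1 / 20) (min (ε / (4 * M + 11)) (η / (4 * M + 11))))
      with hδ
    have hpos : 0 < δ := by positivity
    have a1 : δ ≤ p / 5 := (min_le_left _ _).trans (min_le_left _ _)
    have a2 : δ ≤ s0 / 4 := (min_le_left _ _).trans (min_le_right _ _)
    have a3 : δ ≤ 1 / 20 := (min_le_right _ _).trans (min_le_left _ _)
    have a4 : δ ≤ ε / (4 * M + 11) :=
      (min_le_right _ _).trans ((min_le_right _ _).trans (min_le_left _ _))
    have a5 : δ ≤ η / (4 * M + 11) :=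
      (min_le_right _ _).trans ((min_le_right _ _).trans (min_le_right _ _))
    rw [le_div_iff₀ hMp] at a4 a5
    exact ⟨a1, a2, a3, by nlinarith, by nlinarith⟩
  obtain ⟨H, H1, H2, hHs, hHd, hHd1, hHz, hH10, hH1u, hH0, hHu, hH2z, hH2u, hH2p⟩ :=
    exists_H p (δ / 4) η (by linarith) hη0 (by linarith) (by linarith) (by linarith)
  obtain ⟨W, w, hWs, hws, hWd, hw0, -, hwl, hwz, hWz, hWo, hW0, hW1⟩ :=
    exists_step (p - δ / 2) (5 * δ / 4) (3 * δ / 2) (by linarith) (by linarith)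
  have hK : (2:ℝ) ≤ (k:ℝ) := by exact_mod_cast hk
  set K : ℝ := (k:ℝ) with hKdef
  have hK0 : 0 < K := by linarith
  obtain ⟨A, hA⟩ : ∃ A, A = η / K := ⟨_, rfl⟩
  have hA0 : 0 < A := hA ▸ div_pos hη0 hK0
  have hAK : A * K = η := by rw [hA]; field_simp
  have hns : ContDiff ℝ (⊤ : ℕ∞) (fun r => 5 * A * (S r - W r)) :=
    contDiff_const.mul (hSs.sub hWs)
  obtain ⟨ν, hνs, hνd, hνi⟩ := exists_antideriv _ hns 0
  have hν0 : ν 0 = 0 := by rw [hνi]; simp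
  have dν : deriv ν = fun r => 5 * A * (S r - W r) := funext fun x => (hνd x).deriv
  have ddν : deriv (deriv ν) = fun r => 5 * A * (s r - w r) := by
    rw [dν]; exact funext fun x => (((hSd x).sub (hWd x)).const_mul (5 * A)).deriv
  have hφ1 : ∀ r, HasDerivAt (fun r => sin r + (1 - S r) * H r)
      (cos r + (-s r * H r + (1 - S r) * H1 r)) r := fun r =>
    (hasDerivAt_sin r).add (((hSd r).const_sub 1).mul (hHd r))
  have dφ : deriv (fun r => sin r + (1 - S r) * H r) =
      fun r => cos r + (-s r * H r + (1 - S r) * H1 r) := funext fun r => (hφ1 r).deriv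
  have ddφ : deriv (deriv (fun r => sin r + (1 - S r) * H r)) =
      fun r => -sin r + (-deriv s r * H r - 2 * s r * H1 r + (1 - S r) * H2 r) := by
    rw [dφ]
    funext r
    have h : HasDerivAt (fun r => cos r + (-s r * H r + (1 - S r) * H1 r))
        (-sin r + ((-deriv s r * H r + -s r * H1 r) + (-s r * H1 r + (1 - S r) * H2 r))) r :=
      (hasDerivAt_cos r).add (((hsd r).neg.mul (hHd r)).add
        (((hSd r).const_sub 1).mul (hHd1 r)))
    rw [h.deriv]
    ring
  -- basic facts
  have hs1' : ∀ r, s r ≤ 1 := fun r => (hs1 r).trans (by norm_num)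
  have hsm : ∀ r, r ≤ 1 → s r = 0 := fun r hr => hsz r (by
    rw [abs_sub_comm]; exact le_trans (by linarith) (le_abs_self _))
  have hSm : ∀ r, r ≤ 1 → S r = 0 := fun r hr => hSz r (by linarith)
  have hs'm : ∀ r, r < 1 → deriv s r = 0 := by
    intro r hr
    have : s =ᶠ[nhds r] fun _ => 0 := by
      filter_upwards [Iio_mem_nhds hr] with x hx using hsm x (le_of_lt hx)
    rw [this.deriv_eq]; simp
  have hHδ : ∀ r ∈ Icc 0 π, H r ≤ 4 * δ := by
    intro r hr
    have := hHu r hr.1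
    nlinarith [hr.1, hr.2]
  have hH1δ : ∀ r, H1 r ≤ δ := fun r => by linarith [hH1u r]
  have c0 : ∀ r ∈ Icc 0 π, |(sin r + (1 - S r) * H r) - sin r| ≤ 4 * δ := by
    intro r hr
    rw [add_sub_cancel_left, abs_of_nonneg (mul_nonneg (by linarith [hS1 r]) (hH0 r hr.1))]
    nlinarith [hS0 r, hH0 r hr.1, hHδ r hr, hS1 r]
  have c1 : ∀ r ∈ Icc 0 π, |(cos r + (-s r * H r + (1 - S r) * H1 r)) - cos r| ≤ 4 * δ := by
    intro r hr
    rw [add_sub_cancel_left, abs_le]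
    have e1 : 0 ≤ s r * H r := mul_nonneg (hs0 r) (hH0 r hr.1)
    have e2 : s r * H r ≤ 1 * (4 * δ) := mul_le_mul (hs1' r) (hHδ r hr) (hH0 r hr.1) (by norm_num)
    have e3 : 0 ≤ (1 - S r) * H1 r := mul_nonneg (by linarith [hS1 r]) (hH10 r)
    have e4 : (1 - S r) * H1 r ≤ 1 * δ :=
      mul_le_mul (by linarith [hS0 r]) (hH1δ r) (hH10 r) (by norm_num)
    constructor <;> linarith
  have c2 : ∀ r ∈ Icc 0 π, |-deriv s r * H r - 2 * s r * H1 r| ≤ (4 * M + 10) * δ := by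
    intro r hr
    have e1 : |deriv s r * H r| ≤ M * (4 * δ) := by
      rw [abs_mul, abs_of_nonneg (hH0 r hr.1)]
      exact mul_le_mul (hM r hr) (hHδ r hr) (hH0 r hr.1) hM0
    have e3 : 0 ≤ s r * H1 r := mul_nonneg (hs0 r) (hH10 r)
    have e4 : s r * H1 r ≤ 1 * δ := mul_le_mul (hs1' r) (hH1δ r) (hH10 r) (by norm_num)
    rw [abs_le] at e1 ⊢
    constructor <;> linarith
  have hMδ : 0 ≤ M * δ := by positivity
  have c0' : ∀ r ∈ Icc 0 π, |(sin r + (1 - S r) * H r) - sin r| < ε := fun r hr =>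
    (c0 r hr).trans_lt (by linarith)
  have c1' : ∀ r ∈ Icc 0 π, |(cos r + (-s r * H r + (1 - S r) * H1 r)) - cos r| < ε := fun r hr =>
    (c1 r hr).trans_lt (by linarith)
  have hφle : ∀ r ∈ Icc (0:ℝ) π,
      -sin r + (-deriv s r * H r - 2 * s r * H1 r + (1 - S r) * H2 r) ≤ η := by
    intro r hr
    rcases lt_or_ge r 1 with h | h
    · rw [hsm r h.le, hSm r h.le, hs'm r h]
      have := hH2u r hr
      linarith
    · rw [hH2z r (le_trans (by linarith) (le_abs_self _))]
      have := (abs_le.1 (c2 r hr)).2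
      have := sin_nonneg_of_nonneg_of_le_pi hr.1 hr.2
      linarith
  have hn0 : ∀ r, S r - W r ≤ 0 := by
    intro r
    rcases le_total r 1 with h | h
    · rw [hSm r h]; linarith [hW0 r]
    · rw [hWo r (by linarith)]; linarith [hS1 r]
  have hn1 : ∀ r, -1 ≤ S r - W r := fun r => by linarith [hS0 r, hW1 r]
  have hbd : 20 * η / K = 20 * A := by rw [hA]; ring
  refine ⟨δ, hδ0, by linarith, fun r => sin r + (1 - S r) * H r, ν, ?_, hνs, ?_, ?_, ?_, ?_, ?_,
    ?_, ?_, ?_, ?_, ?_, ?_⟩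
  · exact Real.contDiff_sin.add ((contDiff_const.sub hSs).mul hHs)
  · rintro r ⟨hr, hr'⟩
    rw [ddφ, dφ]
    refine ⟨c0' r hr, c1' r hr, ?_⟩
    have hz : H2 r = 0 := by
      apply hH2z
      by_contra hc
      push Not at hc
      rw [abs_lt] at hc
      exact hr' ⟨by linarith, by linarith⟩
    simp only [hz]
    rw [show -sin r + (-deriv s r * H r - 2 * s r * H1 r + (1 - S r) * 0) + sin r
      = -deriv s r * H r - 2 * s r * H1 r by ring]
    exact (c2 r hr).trans_lt hδe
  · rw [ddφ]
    simp only [hsm p (by linarith), hSm p (by linarith), hs'm p (by linarith), hH2p]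
    ring
  · rw [ddφ]; exact hφle
  · rw [dφ]; exact fun r hr => ⟨c0' r hr, c1' r hr⟩
  · filter_upwards [Iio_mem_nhds (show 0 < p - δ / 4 by linarith)] with r hr
    rw [hHz r (le_of_lt hr)]; ring
  · filter_upwards [Ioi_mem_nhds (show 3 < π by linarith)] with r hr
    rw [hSo r (by linarith [mem_Ioi.1 hr])]; ring
  · intro r hr
    have := sin_pos_of_pos_of_lt_pi hr.1 hr.2
    have := mul_nonneg (show 0 ≤ 1 - S r by linarith [hS1 r]) (hH0 r hr.1.le)
    change 0 < sin r + (1 - S r) * H r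
    linarith
  · refine ⟨0, ?_⟩
    filter_upwards [Iio_mem_nhds (show 0 < p - 2 * δ by linarith)] with r hr
    rw [mem_Iio] at hr
    rw [hνi, intervalIntegral.integral_congr (g := fun _ => (0:ℝ))]
    · simp
    · intro t ht
      have ht' : t ≤ p - 2 * δ := by
        have := ht.2
        exact this.trans (max_le (by linarith) hr.le)
      simp only
      rw [hSm t (by linarith), hWz t (by linarith)]; ring
  · refine ⟨ν 3, ?_⟩
    filter_upwards [Ioi_mem_nhds (show 3 < π by linarith)] with r hr
    rw [mem_Ioi] at hr
    have hz : ∀ x ∈ Icc 3 r, 5 * A * (S x - W x) = 0 := by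
      intro x hx
      rw [hSo x (by linarith [hx.1]), hWo x (by linarith [hx.1])]; ring
    have a1 := mvt_le hνd hr.le (C := 0) (fun x hx => (hz x hx).le)
    have a2 := le_mvt hνd hr.le (C := 0) (fun x hx => (hz x hx).ge)
    linarith
  · rintro r ⟨hr1, hr2⟩
    have hr0 : 0 < r := by linarith
    have hrI : r ∈ Icc 0 π := ⟨hr0.le, by linarith⟩
    have hrlt : r < 1 := by linarith
    rw [ddφ, dφ, ddν, dν]
    simp only [hsm r hrlt.le, hSm r hrlt.le, hs'm r hrlt]
    have hH := hH0 r hr0.le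
    have hHr := hHδ r hrI
    have hsr : s0 ≤ sin r := by
      apply sin_le_sin_of_le_of_le_pi_div_two <;> linarith
    have hcr : 1 / 2 < cos r := by
      rw [← cos_pi_div_three]
      apply cos_lt_cos_of_nonneg_of_le_pi <;> linarith
    have hφpos : 0 < sin r + (1 - 0) * H r := by linarith
    have hKφ := mul_pos hK0 hφpos
    have hwr := hw0 r
    have hWr := hW0 r
    have hW1r := hW1 r
    have hH1r := hH10 r
    have hAle : A ≤ 1 / 20 := by
      rw [hA, div_le_iff₀ hK0]; linarith
    have hsq : (5 * A * (0 - W r)) ^ 2 ≤ 25 * A ^ 2 := by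
      have : W r ^ 2 ≤ 1 := by nlinarith
      nlinarith [sq_nonneg A]
    by_cases hc : δ / 4 ≤ |r - p|
    · rw [hH2z r hc]
      constructor
      · rw [lt_div_iff₀ hKφ]
        have b1 : 5 * A * (0 - w r) ≤ 0 := by nlinarith [mul_nonneg hA0.le hwr]
        have b2 : (5 * A * (0 - w r) + (5 * A * (0 - W r)) ^ 2) * (K * (sin r + (1 - 0) * H r))
            ≤ (25 * A ^ 2) * (K * (2 * sin r)) := by
          apply mul_le_mul (by linarith) _ hKφ.le (by positivity)
          apply mul_le_mul_of_nonneg_left _ hK0.le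
          linarith
        have b3 : 25 * A ^ 2 * (K * (2 * sin r)) = (50 * A * η) * sin r := by
          rw [← hAK]; ring
        have b4 : 50 * A * η < 1 := by nlinarith
        nlinarith
      · have b1 : 0 ≤ A * W r * (cos r + H1 r) := by positivity
        have b2 : 0 < sin r / K := div_pos (by linarith) hK0
        have b3 : -(-sin r + (-0 * H r - 2 * 0 * H1 r + (1 - 0) * 0)) / K = sin r / K := by
          congr 1; ring
        rw [b3]
        nlinarith
    · push Not at hc
      rw [abs_lt] at hc
      have hφ2 := hφle r hrI
      simp only [hsm r hrlt.le, hSm r hrlt.le, hs'm r hrlt] at hφ2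
      set Q := -sin r + (-0 * H r - 2 * 0 * H1 r + (1 - 0) * H2 r) with hQ
      have hwr' : 1 / (2 * (3 * δ / 2)) ≤ w r := by
        apply hwl; rw [abs_le]; constructor <;> linarith
      constructor
      · have d1 : -(A / s0) ≤ -Q / (K * (sin r + (1 - 0) * H r)) := by
          rw [neg_div, neg_le_neg_iff]
          calc Q / (K * (sin r + (1 - 0) * H r)) ≤ η / (K * (sin r + (1 - 0) * H r)) := by
                gcongr
            _ ≤ η / (K * s0) := by
                gcongr
                linarith
            _ = A / s0 := by rw [hA]; field_simp
        have d2 : 4 / (3 * s0) ≤ w r := by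
          refine le_trans ?_ hwr'
          rw [div_le_div_iff₀ (by positivity) (by positivity)]
          linarith
        have d3 : 4 / (3 * s0) = 4 / 3 * (1 / s0) := by field_simp
        have d4 : 1 ≤ 1 / s0 := by rw [le_div_iff₀ hs0pos]; linarith
        have d5 : A / s0 = A * (1 / s0) := by ring
        rw [d5] at d1
        rw [d3] at d2
        refine lt_of_lt_of_le ?_ d1
        have d6 : A * (4 / 3 * (1 / s0)) ≤ A * w r := mul_le_mul_of_nonneg_left d2 hA0.le
        have d7 : A * 1 ≤ A * (1 / s0) := mul_le_mul_of_nonneg_left d4 hA0.le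
        nlinarith
      · have d1 : 1 / 2 ≤ W r := by
          have h := le_mvt hWd (a := p - 7 * δ / 4) (b := r) (by linarith)
            (C := 1 / (2 * (3 * δ / 2))) (fun x hx => by
              apply hwl; rw [abs_le]; constructor <;> linarith [hx.1, hx.2])
          have h2 := hW0 (p - 7 * δ / 4)
          have h3 : 1 / 2 = 1 / (2 * (3 * δ / 2)) * (3 * δ / 2) := by field_simp
          have h4 : 1 / (2 * (3 * δ / 2)) * (3 * δ / 2) ≤
              1 / (2 * (3 * δ / 2)) * (r - (p - 7 * δ / 4)) :=
            mul_le_mul_of_nonneg_left (by linarith) (by positivity)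
          linarith
        have d2 : -A ≤ -Q / K := by
          rw [hA, ← neg_div]; gcongr
        refine lt_of_lt_of_le ?_ d2
        have d3 : 1 / 4 < W r * (cos r + (-0 * H r + (1 - 0) * H1 r)) := by nlinarith
        nlinarith
  · rintro r ⟨hr, hr'⟩
    rw [ddν, dν, hbd]
    have hwz' : w r = 0 := by
      apply hwz
      by_contra hc
      push Not at hc
      rw [abs_lt] at hc
      exact hr' ⟨by linarith, by linarith⟩
    have g0 := hn0 r
    have g1 := hn1 r
    refine ⟨?_, ?_, ?_⟩
    · have a1 := mvt_le hνd hr.1 (C := 0) (fun x hx => by nlinarith [hn0 x])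
      have a2 := le_mvt hνd hr.1 (C := -(5 * A)) (fun x hx => by nlinarith [hn1 x])
      have : A * r ≤ A * 4 := mul_le_mul_of_nonneg_left (by linarith [hr.2]) hA0.le
      rw [abs_le]; constructor <;> linarith
    · rw [abs_le]; constructor <;> nlinarith
    · simp only [hwz']
      rw [abs_le]; constructor <;> nlinarith [hs0 r, hs1' r, mul_nonneg hA0.le (hs0 r)]
end

section
/- For every η ∈ (0, 1), every p ∈ (0, π/4), and every ε > 0, there exist δ ∈ (0, min(p/4, ε)) and a smooth function φ : [0, π] → ℝ such that: φ(r) = sin r for all r in some neighborhood of 0 and some neighborhood of π; φ(r) > 0 for all r ∈ (0, π); |φ(r) − sin r| < ε and |φ′(r) − cos r| < ε for all r ∈ [0, π]; |φ″(r) + sin r| < ε for all r ∈ [0, π] \ (p − δ, p + δ); φ″(p) = η; and φ″(r) ≤ η for all r ∈ [0, π]. -/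
open Real Set

lemma prim_hasDerivAt (g : ℝ → ℝ) (hg : Continuous g) (r : ℝ) :
    HasDerivAt (fun r => ∫ t in (0:ℝ)..r, g t) (g r) r :=
  (hg.integral_hasStrictDerivAt 0 r).hasDerivAt

lemma prim_contDiff (g : ℝ → ℝ) (hg : ContDiff ℝ (⊤ : ℕ∞) g) :
    ContDiff ℝ (⊤ : ℕ∞) (fun r => ∫ t in (0:ℝ)..r, g t) := by
  rw [contDiff_infty_iff_deriv]
  refine ⟨fun r => (prim_hasDerivAt g hg.continuous r).differentiableAt, ?_⟩
  have : deriv (fun r => ∫ t in (0:ℝ)..r, g t) = g :=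
    funext fun r => (prim_hasDerivAt g hg.continuous r).deriv
  rw [this]; exact hg

lemma prim_zero (g : ℝ → ℝ) (a : ℝ) (ha : 0 < a) (hg : ∀ t < a, g t = 0) :
    ∀ r < a, (∫ t in (0:ℝ)..r, g t) = 0 := by
  intro r hr
  have : EqOn g (fun _ => (0:ℝ)) (uIcc 0 r) := by
    intro t ht
    exact hg t (lt_of_le_of_lt ht.2 (max_lt ha hr))
  rw [intervalIntegral.integral_congr this]; simp

lemma prim_bound (g : ℝ → ℝ) (p δ : ℝ) (hδ : 0 < δ)
    (hg2 : ∀ t, |g t| ≤ 2) (hg : ∀ t, δ ≤ |t - p| → g t = 0) (r : ℝ) (hr : 0 ≤ r) :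
    |∫ t in (0:ℝ)..r, g t| ≤ 4 * δ := by
  rw [intervalIntegral.integral_of_le hr]
  have h1 : ∫ t in Ioc 0 r, g t = ∫ t in Ioc 0 r ∩ Icc (p - δ) (p + δ), g t := by
    refine MeasureTheory.setIntegral_eq_of_subset_of_forall_sdiff_eq_zero measurableSet_Ioc
      inter_subset_left ?_
    intro t ht
    apply hg
    by_contra hlt
    push Not at hlt
    rw [abs_lt] at hlt
    exact ht.2 ⟨ht.1, by linarith, by linarith⟩
  rw [h1]
  have hfin : MeasureTheory.volume (Icc (p - δ) (p + δ)) < ⊤ := by simp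
  have h2 := MeasureTheory.norm_setIntegral_le_of_norm_le_const (f := g) (C := 2)
    (μ := MeasureTheory.volume) (s := Ioc 0 r ∩ Icc (p - δ) (p + δ))
    (lt_of_le_of_lt (MeasureTheory.measure_mono inter_subset_right) hfin) (fun t _ => hg2 t)
  have h3 : MeasureTheory.volume.real (Ioc 0 r ∩ Icc (p - δ) (p + δ)) ≤ 2 * δ := by
    refine (MeasureTheory.measureReal_mono inter_subset_right hfin.ne).trans ?_
    rw [Real.volume_real_Icc_of_le (by linarith)]; linarith
  rw [Real.norm_eq_abs] at h2
  linarith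

lemma cutoff_exists : ∃ χ : ℝ → ℝ, ∃ M : ℝ, 1 ≤ M ∧ ContDiff ℝ (⊤ : ℕ∞) χ ∧
    (∀ r, 0 ≤ χ r) ∧ (∀ r, χ r ≤ 1) ∧ (∀ r, 3 ≤ r → χ r = 0) ∧
    (∀ r ∈ Icc (0:ℝ) 1, χ r = 1 ∧ deriv χ r = 0 ∧ deriv (deriv χ) r = 0) ∧
    (∀ r ∈ Icc 0 π, |deriv χ r| ≤ M ∧ |deriv (deriv χ) r| ≤ M) := by
  let f : ContDiffBump (0:ℝ) := ⟨2, 3, by norm_num, by norm_num⟩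
  have hf : ContDiff ℝ (⊤ : ℕ∞) f := f.contDiff
  have hf1 : ContDiff ℝ (⊤ : ℕ∞) (deriv f) := (contDiff_infty_iff_deriv.1 hf).2
  have hf2 : ContDiff ℝ (⊤ : ℕ∞) (deriv (deriv f)) := (contDiff_infty_iff_deriv.1 hf1).2
  obtain ⟨A, hA⟩ := isCompact_Icc.exists_bound_of_continuousOn (s := Icc (0:ℝ) π)
    hf1.continuous.continuousOn
  obtain ⟨B, hB⟩ := isCompact_Icc.exists_bound_of_continuousOn (s := Icc (0:ℝ) π)
    hf2.continuous.continuousOn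
  refine ⟨f, max 1 (max A B), le_max_left _ _, hf, fun r => f.nonneg, fun r => f.le_one, ?_, ?_, ?_⟩
  · intro r hr
    apply f.zero_of_le_dist
    rw [Real.dist_eq, sub_zero]
    exact hr.trans (le_abs_self r)
  · intro r hr
    have hmem : r ∈ Metric.ball (0:ℝ) f.rIn := by
      rw [Metric.mem_ball, Real.dist_eq, sub_zero, abs_of_nonneg hr.1]
      change r < 2
      linarith [hr.2]
    have h := f.eventuallyEq_one_of_mem_ball hmem
    have h1 := h.deriv
    have h2 := h1.deriv
    refine ⟨h.eq_of_nhds, ?_, ?_⟩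
    · rw [h1.eq_of_nhds]; exact deriv_const r (1:ℝ)
    · rw [h2.eq_of_nhds]
      have : deriv (1 : ℝ → ℝ) = fun _ => 0 := funext fun x => deriv_const x (1:ℝ)
      rw [this]; simp
  · intro r hr
    exact ⟨(hA r hr).trans ((le_max_left _ _).trans (le_max_right _ _)),
      (hB r hr).trans ((le_max_right _ _).trans (le_max_right _ _))⟩

/-- First construction step in the proof of Lemma 1: a C¹-small perturbation `φ` of `sin`
on `[0, π]` whose second derivative has a prescribed positive maximum `η` at `p`, is
C²-close to `sin` outside a `δ`-interval around `p`, and agrees with `sin` near the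
endpoints. (`φ` is realized as a smooth function on `ℝ`.) -/
theorem phi_construction (η : ℝ) (hη : η ∈ Ioo (0 : ℝ) 1) (p : ℝ) (hp : p ∈ Ioo 0 (π / 4))
    (ε : ℝ) (hε : 0 < ε) :
    ∃ δ ∈ Ioo (0 : ℝ) (min (p / 4) ε), ∃ φ : ℝ → ℝ, ContDiff ℝ (⊤ : ℕ∞) φ ∧
      (∀ᶠ r in nhds (0 : ℝ), φ r = Real.sin r) ∧
      (∀ᶠ r in nhds π, φ r = Real.sin r) ∧
      (∀ r ∈ Ioo (0 : ℝ) π, 0 < φ r) ∧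
      (∀ r ∈ Icc (0 : ℝ) π, |φ r - Real.sin r| < ε ∧ |deriv φ r - Real.cos r| < ε) ∧
      (∀ r ∈ Icc (0 : ℝ) π \ Ioo (p - δ) (p + δ),
        |deriv (deriv φ) r + Real.sin r| < ε) ∧
      deriv (deriv φ) p = η ∧
      (∀ r ∈ Icc (0 : ℝ) π, deriv (deriv φ) r ≤ η) := by
  obtain ⟨χ, M, hM, hχ, hχ0, hχ1, hχ3, hχe, hχM⟩ := cutoff_exists
  obtain ⟨hη0, hη1⟩ := hη
  obtain ⟨hp0, hp1⟩ := hp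
  have hpi := Real.pi_lt_d2
  have hpi3 := Real.pi_gt_three
  have hM0 : 0 < M := by linarith
  obtain ⟨δ, hδ0, hδ⟩ := exists_between
    (show (0:ℝ) < min (p / 4) (min (ε / (24 * M)) (η / (24 * M))) by positivity)
  rw [lt_min_iff, lt_min_iff, lt_div_iff₀ (by positivity), lt_div_iff₀ (by positivity), lt_div_iff₀ (by positivity)] at hδ
  obtain ⟨hδp, hδε, hδη⟩ := hδ
  have hδM : δ ≤ δ * M := le_mul_of_one_le_right hδ0.le hM
  refine ⟨δ, ⟨hδ0, lt_min (by linarith) (by linarith)⟩, ?_⟩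
  let b : ContDiffBump p := ⟨δ / 2, δ, by linarith, by linarith⟩
  have hb : ContDiff ℝ (⊤ : ℕ∞) b := b.contDiff
  have hbp : b p = 1 := b.eventuallyEq_one.eq_of_nhds
  have hbz : ∀ t, δ ≤ |t - p| → b t = 0 := fun t ht => b.zero_of_le_dist ht
  obtain ⟨g, hgdef⟩ : ∃ g : ℝ → ℝ, g = fun t => (η + Real.sin t) * b t := ⟨_, rfl⟩
  have hg : ContDiff ℝ (⊤ : ℕ∞) g := by
    rw [hgdef]; exact (contDiff_const.add Real.contDiff_sin).mul hb
  have hgz : ∀ t, δ ≤ |t - p| → g t = 0 := fun t ht => by rw [hgdef]; simp [hbz t ht]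
  have hg2 : ∀ t, |g t| ≤ 2 := by
    intro t
    rw [hgdef]
    simp only [abs_mul]
    have h1 : |η + Real.sin t| ≤ 2 := by
      rw [abs_le]
      constructor <;> linarith [Real.neg_one_le_sin t, Real.sin_le_one t]
    have h2 : |b t| ≤ 1 := by rw [abs_of_nonneg b.nonneg]; exact b.le_one
    calc _ ≤ (2:ℝ) * 1 := mul_le_mul h1 h2 (abs_nonneg _) (by norm_num)
      _ = 2 := by norm_num
  have hg0 : ∀ t ∈ Icc 0 π, 0 ≤ g t := by
    intro t ht
    rw [hgdef]
    exact mul_nonneg (add_nonneg hη0.le (Real.sin_nonneg_of_mem_Icc ht)) b.nonneg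
  obtain ⟨G, hGdef⟩ : ∃ G : ℝ → ℝ, G = fun r => ∫ t in (0:ℝ)..r, g t := ⟨_, rfl⟩
  have hG : ContDiff ℝ (⊤ : ℕ∞) G := hGdef ▸ prim_contDiff g hg
  have hGd : ∀ r, HasDerivAt G (g r) r := hGdef ▸ prim_hasDerivAt g hg.continuous
  have hGb : ∀ r, 0 ≤ r → |G r| ≤ 4 * δ := hGdef ▸ prim_bound g p δ hδ0 hg2 hgz
  have hGz : ∀ r < p - δ, G r = 0 := by
    rw [hGdef]
    refine prim_zero g (p - δ) (by linarith) fun t ht => hgz t ?_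
    rw [abs_sub_comm]; exact le_trans (by linarith) (le_abs_self _)
  have hG0 : ∀ t ∈ Icc 0 π, 0 ≤ G t := by
    intro t ht
    rw [hGdef]
    exact intervalIntegral.integral_nonneg ht.1 fun u hu => hg0 u ⟨hu.1, hu.2.trans ht.2⟩
  obtain ⟨H, hHdef⟩ : ∃ H : ℝ → ℝ, H = fun r => ∫ t in (0:ℝ)..r, G t := ⟨_, rfl⟩
  have hH : ContDiff ℝ (⊤ : ℕ∞) H := hHdef ▸ prim_contDiff G hG
  have hHd : ∀ r, HasDerivAt H (G r) r := hHdef ▸ prim_hasDerivAt G hG.continuous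
  have hHz : ∀ r < p - δ, H r = 0 := by
    rw [hHdef]
    exact prim_zero G (p - δ) (by linarith) hGz
  have hH0 : ∀ t ∈ Icc 0 π, 0 ≤ H t := by
    intro t ht
    rw [hHdef]
    exact intervalIntegral.integral_nonneg ht.1 fun u hu => hG0 u ⟨hu.1, hu.2.trans ht.2⟩
  have hHb : ∀ r ∈ Icc 0 π, |H r| ≤ 16 * δ := by
    intro r hr
    rw [hHdef]
    have := intervalIntegral.norm_integral_le_of_norm_le_const (a := 0) (b := r) (f := G)
      (C := 4 * δ) (fun t ht => hGb t (by rw [uIoc_of_le hr.1] at ht; exact ht.1.le))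
    rw [Real.norm_eq_abs, sub_zero, abs_of_nonneg hr.1] at this
    refine this.trans ?_
    nlinarith [hr.2]
  have hχd : ∀ r, HasDerivAt χ (deriv χ r) r := fun r =>
    ((contDiff_infty_iff_deriv.1 hχ).1 r).hasDerivAt
  have hχdd : ∀ r, HasDerivAt (deriv χ) (deriv (deriv χ) r) r := fun r =>
    ((contDiff_infty_iff_deriv.1 (contDiff_infty_iff_deriv.1 hχ).2).1 r).hasDerivAt
  have hd1 : deriv (fun r => Real.sin r + χ r * H r) =
      fun r => Real.cos r + (deriv χ r * H r + χ r * G r) :=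
    funext fun r => ((Real.hasDerivAt_sin r).add ((hχd r).mul (hHd r))).deriv
  have hd2 : deriv (fun r => Real.cos r + (deriv χ r * H r + χ r * G r)) =
      fun r => -Real.sin r + ((deriv (deriv χ) r * H r + deriv χ r * G r) +
        (deriv χ r * G r + χ r * g r)) :=
    funext fun r => ((Real.hasDerivAt_cos r).add (((hχdd r).mul (hHd r)).add
      ((hχd r).mul (hGd r)))).deriv
  have hprod : ∀ x y A B : ℝ, |x| ≤ A → |y| ≤ B → |x * y| ≤ A * B := by
    intro x y A B hx hy
    rw [abs_mul]
    exact mul_le_mul hx hy (abs_nonneg _) ((abs_nonneg _).trans hx)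
  have hχa : ∀ r, |χ r| ≤ 1 := fun r => by rw [abs_of_nonneg (hχ0 r)]; exact hχ1 r
  have herr : ∀ r ∈ Icc 0 π, |deriv (deriv χ) r * H r + deriv χ r * G r + deriv χ r * G r| < min ε η := by
    intro r hr
    have h1 := hprod _ _ _ _ (hχM r hr).2 (hHb r hr)
    have h2 := hprod _ _ _ _ (hχM r hr).1 (hGb r hr.1)
    refine lt_of_le_of_lt ((abs_add_le _ _).trans (add_le_add_left (abs_add_le _ _) _)) ?_
    apply lt_min <;> linarith
  refine ⟨fun r => Real.sin r + χ r * H r, Real.contDiff_sin.add (hχ.mul hH), ?_, ?_, ?_, ?_, ?_, ?_, ?_⟩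
  · filter_upwards [Iio_mem_nhds (show (0:ℝ) < p - δ by linarith)] with r hr
    simp [hHz r hr]
  · filter_upwards [Ioi_mem_nhds hpi3] with r hr
    simp [hχ3 r (le_of_lt hr)]
  · intro r hr
    exact add_pos_of_pos_of_nonneg (Real.sin_pos_of_mem_Ioo hr)
      (mul_nonneg (hχ0 r) (hH0 r ⟨hr.1.le, hr.2.le⟩))
  · intro r hr
    constructor
    · have h1 := hprod _ _ _ _ (hχa r) (hHb r hr)
      simp only [add_sub_cancel_left]
      linarith
    · rw [hd1]
      have h1 := hprod _ _ _ _ (hχM r hr).1 (hHb r hr)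
      have h2 := hprod _ _ _ _ (hχa r) (hGb r hr.1)
      simp only [add_sub_cancel_left]
      refine lt_of_le_of_lt (abs_add_le _ _) ?_
      linarith
  · rintro r ⟨hr, hrn⟩
    rw [hd1, hd2]
    have hgr : g r = 0 := by
      apply hgz
      by_contra hlt
      push Not at hlt
      rw [abs_lt] at hlt
      exact hrn ⟨by linarith, by linarith⟩
    have := lt_of_lt_of_le (herr r hr) (min_le_left _ _)
    simp only [hgr]
    rw [abs_lt] at this ⊢
    constructor <;> linarith [this.1, this.2]
  · rw [hd1, hd2]
    obtain ⟨h1, h2, h3⟩ := hχe p ⟨hp0.le, by linarith⟩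
    simp only [h1, h2, h3, hgdef, hbp]
    ring
  · intro r hr
    rw [hd1, hd2]
    have hs := Real.sin_nonneg_of_mem_Icc hr
    rcases le_total r 1 with h | h
    · obtain ⟨h1, h2, h3⟩ := hχe r ⟨hr.1, h⟩
      simp only [h1, h2, h3, hgdef]
      have := mul_nonneg (add_nonneg hη0.le hs) (sub_nonneg.2 (b.le_one (x := r)))
      linarith
    · have hgr : g r = 0 := hgz r (le_trans (by linarith) (le_abs_self _))
      have := (abs_lt.1 (lt_of_lt_of_le (herr r hr) (min_le_right _ _))).2
      simp only [hgr]
      linarith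
end

section
/- For every C > 0 and every natural number k ≥ 2, there exist smooth functions φ, ν : [0, π] → ℝ, a constant λ ∈ (0, 1], and a point p ∈ (0, π) with the following properties: φ(r) = sin r for all r in some neighborhood of 0 and some neighborhood of π; φ(r) > 0 for all r ∈ (0, π); ν is constant on some neighborhood of 0 and some neighborhood of π; for every r ∈ (0, π): φ″(r) + k·φ(r)·(ν″(r) + ν′(r)²) < 0, φ″(r) + k·ν′(r)·φ′(r) < 0, and λ²·e^{2ν(r)}·(ν″(r) + φ′(r)·ν′(r)/φ(r) + k·ν′(r)²) < 1; and φ″(p)/φ(p) > C. -/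
open Real Set

lemma step_exists : ∃ (S : ℝ → ℝ) (M t : ℝ), ContDiff ℝ (⊤ : ℕ∞) S ∧ (∀ x ≤ 0, S x = 0) ∧
    (∀ x, 1 ≤ x → S x = 1) ∧ (∀ x, 0 ≤ S x) ∧ (∀ x, S x ≤ 1) ∧ (∀ x, 0 ≤ deriv S x) ∧
    (∀ x, deriv S x ≤ M) ∧ 0 < M ∧ 0 < t ∧ t < 1 ∧ 0 < S t ∧ deriv S t = 1 := by
  have hS : ContDiff ℝ (⊤ : ℕ∞) Real.smoothTransition := Real.smoothTransition.contDiff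
  have hd : Differentiable ℝ Real.smoothTransition := hS.differentiable (by simp)
  have hc : Continuous (deriv Real.smoothTransition) := hS.continuous_deriv (by simp)
  obtain ⟨t, ht, hts⟩ := exists_deriv_eq_slope Real.smoothTransition (zero_lt_one' ℝ)
    hS.continuous.continuousOn hd.differentiableOn
  rw [Real.smoothTransition.one, Real.smoothTransition.zero] at hts
  obtain ⟨M, hM⟩ := (isCompact_Icc (a := (0:ℝ)) (b := 1)).exists_bound_of_continuousOn hc.continuousOn
  refine ⟨Real.smoothTransition, max M 1, t, hS, fun x hx => Real.smoothTransition.zero_of_nonpos hx,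
    fun x hx => Real.smoothTransition.one_of_one_le hx, Real.smoothTransition.nonneg,
    Real.smoothTransition.le_one, fun x => Real.smoothTransition.monotone.deriv_nonneg, ?_, by positivity, ht.1, ht.2,
    Real.smoothTransition.pos_of_pos ht.1, by rw [hts]; norm_num⟩
  intro x
  by_cases h0 : x < 0
  · have : Real.smoothTransition =ᶠ[nhds x] fun _ => 0 := by
      filter_upwards [Iio_mem_nhds h0] with y hy using Real.smoothTransition.zero_of_nonpos (le_of_lt hy)
    rw [this.deriv_eq]; simp
  by_cases h1 : 1 < x
  · have : Real.smoothTransition =ᶠ[nhds x] fun _ => 1 := by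
      filter_upwards [Ioi_mem_nhds h1] with y hy using Real.smoothTransition.one_of_one_le (le_of_lt hy)
    rw [this.deriv_eq]; simp
  · exact le_max_of_le_left ((le_abs_self _).trans (hM x ⟨not_lt.1 h0, not_lt.1 h1⟩))

lemma bump_exists : ∃ (β : ℝ → ℝ) (q B : ℝ), ContDiff ℝ (⊤ : ℕ∞) β ∧ deriv (deriv β) q = 1 ∧
    (∀ x, deriv (deriv β) x ≤ 1) ∧
    (∀ x, |x| ≤ 1 ∨ (β x = 0 ∧ deriv β x = 0 ∧ deriv (deriv β) x = 0)) ∧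
    (∀ x, |β x| ≤ B) ∧ (∀ x, |deriv β x| ≤ B) ∧ |q| ≤ 1 := by
  let χ : ContDiffBump (0:ℝ) := ⟨1/4, 1, by norm_num, by norm_num⟩
  let g : ℝ → ℝ := fun x => x ^ 2 / 2 * χ x
  have hg : ContDiff ℝ (⊤ : ℕ∞) g := by
    have := χ.contDiff (n := (⊤ : ℕ∞))
    fun_prop
  have hg1 : ContDiff ℝ (⊤ : ℕ∞) (deriv g) := (contDiff_infty_iff_deriv.1 hg).2
  have hg2 : ContDiff ℝ (⊤ : ℕ∞) (deriv (deriv g)) := (contDiff_infty_iff_deriv.1 hg1).2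
  have hcs : HasCompactSupport g := χ.hasCompactSupport.mul_left
  have hts : tsupport g ⊆ Metric.closedBall 0 1 := by
    have : tsupport χ = Metric.closedBall 0 1 := χ.tsupport_eq
    rw [← this]; exact tsupport_mul_subset_right
  have hs2 : ∀ x, |x| ≤ 1 ∨ (g x = 0 ∧ deriv g x = 0 ∧ deriv (deriv g) x = 0) := by
    intro x
    by_cases hx : x ∈ tsupport g
    · left; simpa using hts hx
    · right
      have h1 : x ∉ tsupport (deriv g) := fun h => hx (tsupport_deriv_subset h)
      have h2 : x ∉ tsupport (deriv (deriv g)) := fun h => h1 (tsupport_deriv_subset h)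
      exact ⟨image_eq_zero_of_notMem_tsupport hx, image_eq_zero_of_notMem_tsupport h1,
        image_eq_zero_of_notMem_tsupport h2⟩
  have h00 : deriv (deriv g) 0 = 1 := by
    have e : g =ᶠ[nhds 0] fun x => x ^ 2 / 2 := by
      filter_upwards [Metric.ball_mem_nhds (0:ℝ) (show (0:ℝ) < 1/4 by norm_num)] with x hx
      have : χ x = 1 := χ.one_of_mem_closedBall (Metric.ball_subset_closedBall hx)
      simp [g, this]
    have e2 : deriv (fun x : ℝ => x ^ 2 / 2) = fun x => x := by
      ext x; simp
    rw [e.deriv.deriv_eq, e2]; simp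
  have hcont := hg2.continuous
  obtain ⟨q, hq, hmax⟩ := (isCompact_Icc (a := (-1:ℝ)) (b := 1)).exists_isMaxOn ⟨0, by simp⟩
    hcont.continuousOn
  set m := deriv (deriv g) q with hm
  have hm1 : 1 ≤ m := by rw [← h00]; exact hmax (by simp)
  have hall : ∀ x, deriv (deriv g) x ≤ m := by
    intro x
    rcases hs2 x with h | h
    · exact hmax (abs_le.1 h)
    · rw [h.2.2]; linarith
  obtain ⟨B1, hB1⟩ := hcs.exists_bound_of_continuous hg.continuous
  obtain ⟨B2, hB2⟩ := hcs.deriv.exists_bound_of_continuous hg1.continuous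
  have hm0 : 0 < m := by linarith
  have d1 : deriv (fun x => m⁻¹ * g x) = fun x => m⁻¹ * deriv g x := by
    ext x; simp
  have d2 : deriv (fun x => m⁻¹ * deriv g x) = fun x => m⁻¹ * deriv (deriv g) x := by
    ext x; simp
  have hi : m⁻¹ ≤ 1 := inv_le_one_of_one_le₀ hm1
  have hi0 : 0 < m⁻¹ := by positivity
  refine ⟨fun x => m⁻¹ * g x, q, max B1 B2, by fun_prop, ?_, ?_, ?_, ?_, ?_, abs_le.2 hq⟩
  · rw [d1, d2]; simp only [← hm]; field_simp
  · intro x; rw [d1, d2]; simp only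
    rw [inv_mul_le_iff₀ hm0]; simpa using hall x
  · intro x; rw [d1, d2]
    rcases hs2 x with h | h
    · exact Or.inl h
    · right; simp [h]
  · intro x
    have := hB1 x
    rw [Real.norm_eq_abs] at this
    rw [abs_mul, abs_of_pos hi0]
    exact (mul_le_of_le_one_left (abs_nonneg _) hi).trans (this.trans (le_max_left _ _))
  · intro x; rw [d1]
    have := hB2 x
    rw [Real.norm_eq_abs] at this
    simp only
    rw [abs_mul, abs_of_pos hi0]
    exact (mul_le_of_le_one_left (abs_nonneg _) hi).trans (this.trans (le_max_right _ _))

lemma u_exists (C : ℝ) (hC : 0 < C) (k : ℝ) (hk : 2 ≤ k) : ∃ (u : ℝ → ℝ) (c p : ℝ),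
    ContDiff ℝ (⊤ : ℕ∞) u ∧ 0 < c ∧ 0 < p ∧ p < 3/2 ∧ (∀ r ≤ c, u r = 0) ∧
    (∀ r, 3/2 ≤ r → u r = 0) ∧ (∀ r, u r ≤ 0) ∧ (∀ r, k * (deriv u r + u r ^ 2) < 1) ∧
    C + 1 + k * (deriv u p + u p ^ 2) < 0 ∧ (C + 1) * Real.sin p + k * u p * Real.cos p < 0 := by
  obtain ⟨S, M, t, hS, hS0, hS1, hSn, hSl, hd0, hdM, hM, ht0, ht1, hSt, hdt⟩ := step_exists
  have hdiff : Differentiable ℝ S := hS.differentiable (by simp)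
  have hk0 : 0 < k := by linarith
  -- amplitude
  obtain ⟨a, ha0, ha1, haM⟩ : ∃ a : ℝ, 0 < a ∧ a ≤ 1 ∧ k * (a * (2 * M + 1)) < 1 := by
    refine ⟨1 / (k * (2 * M + 1) + 1), by positivity, ?_, ?_⟩
    · rw [div_le_one (by positivity)]
      have : 0 < k * (2 * M + 1) := by positivity
      linarith
    · have : 0 < k * (2 * M + 1) := by positivity
      rw [show k * (1 / (k * (2 * M + 1) + 1) * (2 * M + 1)) = (k * (2 * M + 1)) / (k * (2 * M + 1) + 1) by ring]
      rw [div_lt_one (by positivity)]; linarith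
  -- large n
  obtain ⟨n, hn1, hn2, hn3⟩ : ∃ n : ℝ, 4 ≤ n ∧ C + 1 + k * (a ^ 2 - a * n) < 0 ∧
      (C + 1) * Real.sin ((1 + t) / n) - k * (a * S t) * Real.cos ((1 + t) / n) < 0 := by
    have hl : Filter.Tendsto (fun n : ℝ => (1 + t) / n) Filter.atTop (nhds 0) :=
      Filter.Tendsto.div_atTop tendsto_const_nhds Filter.tendsto_id
    have hf : Continuous (fun x : ℝ => (C + 1) * Real.sin x - k * (a * S t) * Real.cos x) := by
      fun_prop
    have h3 := (hf.tendsto 0).comp hl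
    have h3' := h3.eventually (Iio_mem_nhds (show (C + 1) * Real.sin 0 - k * (a * S t) * Real.cos 0 < 0 by
      simp; positivity))
    have h2 : ∀ᶠ n : ℝ in Filter.atTop, (C + 1 + k * a ^ 2) / (k * a) < n := Filter.eventually_gt_atTop _
    obtain ⟨n, h1, h2, h3⟩ := ((Filter.eventually_ge_atTop (4:ℝ)).and (h2.and h3')).exists
    refine ⟨n, h1, ?_, h3⟩
    rw [div_lt_iff₀ (by positivity)] at h2
    nlinarith
  have hn0 : 0 < n := by linarith
  have hu' : ∀ r, HasDerivAt (fun r => -a * (S (n * r - 1) * S (3 - 2 * r)))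
      (-a * ((deriv S (n * r - 1) * n) * S (3 - 2 * r) + S (n * r - 1) * (deriv S (3 - 2 * r) * (-2)))) r := by
    intro r
    have e1 : HasDerivAt (fun r : ℝ => n * r - 1) n r := by
      simpa using ((hasDerivAt_id r).const_mul n).sub_const 1
    have e2 : HasDerivAt (fun r : ℝ => 3 - 2 * r) (-2) r := by
      simpa using ((hasDerivAt_id r).const_mul 2).const_sub 3
    have f1 := (hdiff (n * r - 1)).hasDerivAt.comp r e1
    have f2 := (hdiff (3 - 2 * r)).hasDerivAt.comp r e2
    exact (f1.mul f2).const_mul (-a)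
  have hp1 : (1 + t) / n < 1 := by rw [div_lt_one hn0]; linarith
  have hpe : n * ((1 + t) / n) - 1 = t := by field_simp; ring
  refine ⟨fun r => -a * (S (n * r - 1) * S (3 - 2 * r)), 1 / n, (1 + t) / n, by fun_prop, by positivity,
    by positivity, by linarith, ?_, ?_, ?_, ?_, ?_, ?_⟩
  · intro r hr
    rw [le_div_iff₀ hn0] at hr
    simp [hS0 (n * r - 1) (by linarith)]
  · intro r hr
    simp [hS0 (3 - 2 * r) (by linarith)]
  · intro r
    have := mul_nonneg ha0.le (mul_nonneg (hSn (n * r - 1)) (hSn (3 - 2 * r)))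
    simp only; linarith
  · intro r
    rw [(hu' r).deriv]
    beta_reduce
    have A := hSn (n * r - 1)
    have A' := hSl (n * r - 1)
    have B := hSn (3 - 2 * r)
    have B' := hSl (3 - 2 * r)
    have D := hd0 (n * r - 1)
    have E := hd0 (3 - 2 * r)
    have E' := hdM (3 - 2 * r)
    generalize S (n * r - 1) = x at *
    generalize S (3 - 2 * r) = y at *
    generalize deriv S (n * r - 1) = z at *
    generalize deriv S (3 - 2 * r) = w at *
    have q1 : 0 ≤ a * (z * n * y) := by positivity
    have q2 : x * w ≤ M := (mul_le_of_le_one_left E A').trans E'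
    have q3 : x * y ≤ 1 := mul_le_one₀ A' B B'
    have q4 : (x * y) ^ 2 ≤ 1 := pow_le_one₀ (by positivity) q3
    have q5 : a ^ 2 * (x * y) ^ 2 ≤ a := by
      have : a ^ 2 ≤ a := by nlinarith
      calc _ ≤ a ^ 2 * 1 := by gcongr
        _ ≤ a := by linarith
    have q6 : a * (x * w) ≤ a * M := by gcongr
    refine lt_of_le_of_lt (mul_le_mul_of_nonneg_left ?_ hk0.le) haM
    nlinarith
  · rw [(hu' _).deriv]
    beta_reduce
    rw [hpe, hdt]
    have y1 : S (3 - 2 * ((1 + t) / n)) = 1 := hS1 _ (by linarith)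
    have y2 : deriv S (3 - 2 * ((1 + t) / n)) = 0 := by
      have : S =ᶠ[nhds (3 - 2 * ((1 + t) / n))] fun _ => 1 := by
        filter_upwards [Ioi_mem_nhds (show 1 < 3 - 2 * ((1 + t) / n) by linarith)] with y hy using hS1 _ (le_of_lt hy)
      rw [this.deriv_eq]; simp
    rw [y1, y2]
    have : (S t) ^ 2 ≤ 1 := pow_le_one₀ hSt.le (hSl t)
    have : a ^ 2 * (S t) ^ 2 ≤ a ^ 2 * 1 := by gcongr
    have h := mul_le_mul_of_nonneg_left this hk0.le
    nlinarith
  · have y1 : S (3 - 2 * ((1 + t) / n)) = 1 := hS1 _ (by linarith)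
    simp only [hpe, y1]
    linarith

/-- Analytic core of Theorem 1 of the paper: for every `C > 0` and every fiber dimension
`k ≥ 2` there are smooth `φ, ν : [0, π] → ℝ` (realized as smooth functions on `ℝ`), a
scaling constant `λ ∈ (0, 1]`, and a point `p ∈ (0, π)` such that the warped product
metric `e^{2ν} λ² g_F + g_φ` on `S² × F` has positive Ricci curvature (the three
inequalities), while the base `S²_φ` has Ricci curvature `-φ″(p)/φ(p) < -C` at `p`. -/
theorem main_theorem_analytic (C : ℝ) (hC : 0 < C) (k : ℕ) (hk : 2 ≤ k) :
    ∃ φ ν : ℝ → ℝ, ∃ lam : ℝ, lam ∈ Ioc (0 : ℝ) 1 ∧ ∃ p ∈ Ioo (0 : ℝ) π,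
      ContDiff ℝ (⊤ : ℕ∞) φ ∧ ContDiff ℝ (⊤ : ℕ∞) ν ∧
      (∀ᶠ r in nhds (0 : ℝ), φ r = Real.sin r) ∧
      (∀ᶠ r in nhds π, φ r = Real.sin r) ∧
      (∀ r ∈ Ioo (0 : ℝ) π, 0 < φ r) ∧
      (∃ c : ℝ, ∀ᶠ r in nhds (0 : ℝ), ν r = c) ∧
      (∃ c : ℝ, ∀ᶠ r in nhds π, ν r = c) ∧
      (∀ r ∈ Ioo (0 : ℝ) π,
        deriv (deriv φ) r + k * φ r * (deriv (deriv ν) r + (deriv ν r) ^ 2) < 0 ∧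
        deriv (deriv φ) r + k * deriv ν r * deriv φ r < 0 ∧
        lam ^ 2 * Real.exp (2 * ν r) *
          (deriv (deriv ν) r + deriv φ r * deriv ν r / φ r + k * (deriv ν r) ^ 2) < 1) ∧
      deriv (deriv φ) p / φ p > C := by
  have hk' : (2:ℝ) ≤ k := by exact_mod_cast hk
  have hk0 : (0:ℝ) < k := by linarith
  obtain ⟨u, c, p, hu, hc, hp0, hp1, huc, hu3, hun, hu1, hup1, hup2⟩ := u_exists C hC k hk'
  obtain ⟨β, q, B, hβ, hq1, hβ1, hβs, hB, hB', hq⟩ := bump_exists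
  have hπ := Real.pi_gt_three
  have hsp : 0 < Real.sin p := Real.sin_pos_of_pos_of_lt_pi hp0 (by linarith)
  have hu' : ContDiff ℝ (⊤ : ℕ∞) (deriv u) := (contDiff_infty_iff_deriv.1 hu).2
  have hβ' : ContDiff ℝ (⊤ : ℕ∞) (deriv β) := (contDiff_infty_iff_deriv.1 hβ).2
  have hucont := hu.continuous
  have hu'cont := hu'.continuous
  set D : ℝ := (C + 2) * Real.sin p with hD
  have hD0 : 0 < D := by positivity
  -- the robust neighbourhood
  have hev : ∀ᶠ x : ℝ × ℝ × ℝ in nhds (p, 0, 0),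
      0 < Real.sin x.1 + x.2.1 ∧
      -Real.sin x.1 + D + k * (Real.sin x.1 + x.2.1) * (deriv u x.1 + u x.1 ^ 2) < 0 ∧
      -Real.sin x.1 + D + k * u x.1 * (Real.cos x.1 + x.2.2) < 0 ∧
      0 < -Real.sin x.1 + D - C * (Real.sin x.1 + x.2.1) := by
    refine Filter.Eventually.and ?_ (Filter.Eventually.and ?_ (Filter.Eventually.and ?_ ?_))
    · refine ContinuousAt.eventually_lt (by fun_prop) (by fun_prop) ?_
      simpa using hsp
    · refine ContinuousAt.eventually_lt (by fun_prop) (by fun_prop) ?_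
      simp only [add_zero, hD]
      nlinarith
    · refine ContinuousAt.eventually_lt (by fun_prop) (by fun_prop) ?_
      simp only [add_zero, hD]
      nlinarith
    · refine ContinuousAt.eventually_lt (by fun_prop) (by fun_prop) ?_
      simp only [add_zero, hD]
      nlinarith
  obtain ⟨δ, hδ, hball⟩ := Metric.eventually_nhds_iff.1 hev
  obtain ⟨ε, hε0, hε1, hε2, hε3, hε4, hε5⟩ : ∃ ε : ℝ, 0 < ε ∧ ε < δ ∧ ε < p ∧ ε < 1 ∧
      D * ε ^ 2 * B < δ ∧ D * ε * B < δ := by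
    have h1 : ∀ᶠ ε : ℝ in nhdsWithin 0 (Ioi 0), ε < δ ∧ ε < p ∧ ε < 1 ∧
      D * ε ^ 2 * B < δ ∧ D * ε * B < δ := by
      apply Filter.Eventually.filter_mono nhdsWithin_le_nhds
      refine Filter.Eventually.and ?_ (Filter.Eventually.and ?_ (Filter.Eventually.and ?_
        (Filter.Eventually.and ?_ ?_))) <;>
      · refine ContinuousAt.eventually_lt (by fun_prop) (by fun_prop) ?_
        simp [hδ, hp0]
    obtain ⟨ε, h, h0⟩ := (h1.and self_mem_nhdsWithin).exists
    exact ⟨ε, h0, h⟩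
  set φ : ℝ → ℝ := fun r => Real.sin r + D * ε ^ 2 * β ((r - p) / ε) with hφ
  have hlin : ∀ r, HasDerivAt (fun r : ℝ => (r - p) / ε) (1 / ε) r := fun r =>
    ((hasDerivAt_id r).sub_const p).div_const ε
  have hφ1 : deriv φ = fun r => Real.cos r + D * ε * deriv β ((r - p) / ε) := by
    ext r
    have h1 := ((hβ.differentiable (by simp)) ((r - p) / ε)).hasDerivAt.comp r (hlin r)
    have h2 := (Real.hasDerivAt_sin r).add (h1.const_mul (D * ε ^ 2))
    refine h2.deriv.trans ?_
    field_simp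
  have hφ2 : deriv (deriv φ) = fun r => -Real.sin r + D * deriv (deriv β) ((r - p) / ε) := by
    rw [hφ1]
    ext r
    have h1 := ((hβ'.differentiable (by simp)) ((r - p) / ε)).hasDerivAt.comp r (hlin r)
    have h2 := (Real.hasDerivAt_cos r).add (h1.const_mul (D * ε))
    refine h2.deriv.trans ?_
    field_simp
  have hφs : ContDiff ℝ (⊤ : ℕ∞) φ := by
    have : ContDiff ℝ (⊤ : ℕ∞) fun r : ℝ => (r - p) / ε := by fun_prop
    have := hβ.comp this
    exact Real.contDiff_sin.add (contDiff_const.mul this)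
  -- inside the support of the bump, the robust estimates hold
  have hin : ∀ r, |(r - p) / ε| ≤ 1 → 0 < φ r ∧
      -Real.sin r + D + k * φ r * (deriv u r + u r ^ 2) < 0 ∧
      -Real.sin r + D + k * u r * deriv φ r < 0 ∧ 0 < -Real.sin r + D - C * φ r := by
    intro r hr
    have := @hball (r, D * ε ^ 2 * β ((r - p) / ε), D * ε * deriv β ((r - p) / ε)) ?_
    · rw [hφ1]
      exact this
    · rw [Prod.dist_eq, Prod.dist_eq]
      simp only [Real.dist_eq, sub_zero]
      rw [abs_div, abs_of_pos hε0, div_le_one hε0] at hr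
      refine max_lt (by linarith) (max_lt ?_ ?_)
      · rw [abs_mul, abs_of_pos (show 0 < D * ε ^ 2 by positivity)]
        refine lt_of_le_of_lt ?_ hε4
        gcongr
        exact hB _
      · rw [abs_mul, abs_of_pos (show 0 < D * ε by positivity)]
        refine lt_of_le_of_lt ?_ hε5
        gcongr
        exact hB' _
  have hφpos : ∀ r ∈ Ioo (0 : ℝ) π, 0 < φ r := by
    intro r hr
    rcases hβs ((r - p) / ε) with h | h
    · exact (hin r h).1
    · simp only [hφ, h.1, mul_zero, add_zero]
      exact Real.sin_pos_of_pos_of_lt_pi hr.1 hr.2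
  have hfar : ∀ r, ε < |r - p| → φ r = Real.sin r := by
    intro r hr
    rcases hβs ((r - p) / ε) with h | h
    · rw [abs_div, abs_of_pos hε0, div_le_one hε0] at h
      linarith
    · simp [hφ, h.1]
  set ν : ℝ → ℝ := fun r => ∫ x in (0:ℝ)..r, u x with hν
  have hνd : ∀ r, HasDerivAt ν (u r) r := fun r =>
    intervalIntegral.integral_hasDerivAt_right (hucont.intervalIntegrable _ _)
      hucont.aestronglyMeasurable.stronglyMeasurableAtFilter hucont.continuousAt
  have hν1 : deriv ν = u := funext fun r => (hνd r).deriv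
  have hνs : ContDiff ℝ (⊤ : ℕ∞) ν :=
    contDiff_infty_iff_deriv.2 ⟨fun r => (hνd r).differentiableAt, by rw [hν1]; exact hu⟩
  have hνcont := hνs.continuous
  have hz1 : ∀ r < c, deriv u r = 0 := by
    intro r hr
    have : u =ᶠ[nhds r] fun _ => 0 := by
      filter_upwards [Iio_mem_nhds hr] with y hy using huc y (le_of_lt hy)
    rw [this.deriv_eq]; simp
  have hz2 : ∀ r, 3/2 < r → deriv u r = 0 := by
    intro r hr
    have : u =ᶠ[nhds r] fun _ => 0 := by
      filter_upwards [Ioi_mem_nhds hr] with y hy using hu3 y (le_of_lt hy)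
    rw [this.deriv_eq]; simp
  -- the vertical quantity is bounded
  have hφcont := hφs.continuous
  have hφ'cont : Continuous (deriv φ) := hφs.continuous_deriv (by simp)
  obtain ⟨M, hM⟩ := (isCompact_Icc (a := c / 2) (b := 2)).exists_bound_of_continuousOn
    (f := fun r => Real.exp (2 * ν r) * (deriv u r + deriv φ r * u r / φ r + k * u r ^ 2)) (by
      apply ContinuousOn.mul (by fun_prop)
      apply ContinuousOn.add (ContinuousOn.add (by fun_prop) _) (by fun_prop)
      apply ContinuousOn.div (by fun_prop) (by fun_prop)
      intro r hr
      exact (hφpos r ⟨by linarith [hr.1], by linarith [hr.2]⟩).ne')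
  have hQ : ∀ r, Real.exp (2 * ν r) * (deriv u r + deriv φ r * u r / φ r + k * u r ^ 2) ≤ |M| := by
    intro r
    by_cases h1 : r < c
    · simp [hz1 r h1, huc r h1.le]
    by_cases h2 : 3/2 < r
    · simp [hz2 r h2, hu3 r h2.le]
    exact (le_abs_self _).trans ((hM r ⟨by linarith, by linarith⟩).trans (le_abs_self _))
  have hM0 := abs_nonneg M
  have hl0 : 0 < 1 / (1 + |M|) := by positivity
  have hl1 : 1 / (1 + |M|) ≤ 1 := by rw [div_le_one (by positivity)]; linarith
  have hqε : |ε * q| ≤ ε := by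
    rw [abs_mul, abs_of_pos hε0]; exact mul_le_of_le_one_right hε0.le hq
  rw [abs_le] at hqε
  have hqe : (p + ε * q - p) / ε = q := by field_simp; ring
  refine ⟨φ, ν, 1 / (1 + |M|), ⟨hl0, hl1⟩, p + ε * q, ⟨by linarith, by linarith⟩, hφs, hνs,
    ?_, ?_, hφpos, ?_, ?_, ?_, ?_⟩
  · filter_upwards [Iio_mem_nhds (show 0 < p - ε by linarith)] with r hr
    refine hfar r ?_
    rw [mem_Iio] at hr
    rw [lt_abs]; right; linarith
  · filter_upwards [Ioi_mem_nhds (show p + ε < π by linarith)] with r hr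
    refine hfar r ?_
    rw [mem_Ioi] at hr
    rw [lt_abs]; left; linarith
  · refine ⟨0, ?_⟩
    filter_upwards [Iio_mem_nhds hc] with r hr
    rw [hν]
    apply intervalIntegral.integral_zero_ae
    refine Filter.Eventually.of_forall fun x hx => huc x ?_
    rw [mem_uIoc] at hx
    rw [mem_Iio] at hr
    rcases hx with hx | hx <;> linarith
  · refine ⟨ν π, ?_⟩
    filter_upwards [Ioi_mem_nhds (show 3/2 < π by linarith)] with r hr
    have h1 := intervalIntegral.integral_interval_sub_left (μ := MeasureTheory.volume)
      (hucont.intervalIntegrable 0 r) (hucont.intervalIntegrable 0 π)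
    have h2 : ∫ x in π..r, u x = 0 := by
      apply intervalIntegral.integral_zero_ae
      refine Filter.Eventually.of_forall fun x hx => hu3 x ?_
      rw [mem_uIoc] at hx
      rw [mem_Ioi] at hr
      rcases hx with hx | hx <;> linarith
    rw [h2] at h1
    exact sub_eq_zero.1 h1
  · intro r hr
    have hsr := Real.sin_pos_of_pos_of_lt_pi hr.1 hr.2
    rw [hν1]
    refine ⟨?_, ?_, ?_⟩
    · rcases hβs ((r - p) / ε) with h | h
      · have h1 := (hin r h).2.1
        have h2 : D * deriv (deriv β) ((r - p) / ε) ≤ D := mul_le_of_le_one_right hD0.le (hβ1 _)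
        rw [hφ2]; simp only; linarith
      · rw [hφ2]
        simp only [hφ, h.1, h.2.2, mul_zero, add_zero]
        have := mul_lt_mul_of_pos_left (hu1 r) hsr
        nlinarith
    · rcases hβs ((r - p) / ε) with h | h
      · have h1 := (hin r h).2.2.1
        have h2 : D * deriv (deriv β) ((r - p) / ε) ≤ D := mul_le_of_le_one_right hD0.le (hβ1 _)
        rw [hφ2]; simp only; linarith
      · rw [hφ2, hφ1]
        simp only [h.2.1, h.2.2, mul_zero, add_zero]
        by_cases h32 : 3/2 ≤ r
        · rw [hu3 r h32]; simpa using hsr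
        · have hcos : 0 ≤ Real.cos r :=
            Real.cos_nonneg_of_mem_Icc ⟨by linarith [hr.1], by linarith⟩
          have := mul_nonneg (mul_nonneg hk0.le (neg_nonneg.2 (hun r))) hcos
          linarith
    · have h1 := hQ r
      set l := 1 / (1 + |M|) with hl
      have h2 : l ^ 2 * |M| < 1 := by
        have h3 : l * |M| < 1 := by
          rw [hl, one_div, inv_mul_lt_iff₀ (by positivity)]; linarith
        calc l ^ 2 * |M| = l * (l * |M|) := by ring
          _ ≤ 1 * (l * |M|) := by gcongr
          _ < 1 := by linarith
      rw [mul_assoc]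
      exact lt_of_le_of_lt (mul_le_mul_of_nonneg_left h1 (by positivity)) h2
  · have h := hin (p + ε * q) (by rw [hqe]; exact hq)
    rw [gt_iff_lt, lt_div_iff₀ h.1, hφ2]
    simp only [hqe, hq1]
    linarith [h.2.2.2]
end
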